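/- Let A, λ be real numbers with A - λ² ≥ 0 and λ² ≥ 0, let N ≥ 1 be an integer, and let u be a family of nonnegative real numbers indexed by the integers. For each integer m define r m := -(m-2)²λ²·u (m-2) + (m-1)(A - 2λ²)·u (m-1) + (2Am + λ²m²)·u m + A(m+1)·u (m+1). Then for all integers k ≥ j ≥ 0 one has: the sum over i = 0, 1, ..., k - j of r (N+3+2j+2i) is at least -(N+1+2j)²λ²·u (N+1+2j) + (N+2+2j)(A - 2λ²)·u (N+2+2j). -/

import Mathlib

open Finset

/-- Partial sums of `r` along a progression of step two dominate the boundary terms at both ends. -/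
theorem boundary_terms_le_sum_step_two
    {A lam : ℝ} (h : 0 ≤ A - lam ^ 2) {u r : ℤ → ℝ} (hu : ∀ n : ℤ, 0 ≤ u n)
    (hr : ∀ m : ℤ, r m = -((m : ℝ) - 2) ^ 2 * lam ^ 2 * u (m - 2)
      + ((m : ℝ) - 1) * (A - 2 * lam ^ 2) * u (m - 1)
      + (2 * A * (m : ℝ) + lam ^ 2 * (m : ℝ) ^ 2) * u m
      + A * ((m : ℝ) + 1) * u (m + 1))
    {M : ℤ} (hM : 0 ≤ M) (n : ℕ) :
    -((M : ℝ) - 2) ^ 2 * lam ^ 2 * u (M - 2) + ((M : ℝ) - 1) * (A - 2 * lam ^ 2) * u (M - 1)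
      + lam ^ 2 * ((M : ℝ) + 2 * n) ^ 2 * u (M + 2 * n)
      + A * ((M : ℝ) + 2 * n + 1) * u (M + 2 * n + 1)
      ≤ ∑ i ∈ Finset.range (n + 1), r (M + 2 * (i : ℤ)) := by
  have hA : 0 ≤ A := by nlinarith [sq_nonneg lam]
  have hM' : (0 : ℝ) ≤ M := by exact_mod_cast hM
  induction n with
  | zero =>
    have hpos := mul_nonneg (mul_nonneg hA hM') (hu M)
    simp only [zero_add, Finset.sum_range_one, Nat.cast_zero, mul_zero, add_zero, hr]
    linarith
  | succ n ih =>
    rw [Finset.sum_range_succ, hr (M + 2 * ((n + 1 : ℕ) : ℤ))]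
    have e1 : M + 2 * ((n + 1 : ℕ) : ℤ) - 2 = M + 2 * n := by push_cast; ring
    have e2 : M + 2 * ((n + 1 : ℕ) : ℤ) - 1 = M + 2 * n + 1 := by push_cast; ring
    rw [e1, e2]
    have hpos : 0 ≤ A * ((M : ℝ) + 2 * (n + 1)) * u (M + 2 * ((n + 1 : ℕ) : ℤ)) :=
      mul_nonneg (by positivity) (hu _)
    have hpos' : 0 ≤ (A - lam ^ 2) * ((M : ℝ) + 2 * n + 1) * u (M + 2 * n + 1) :=
      mul_nonneg (mul_nonneg h (by positivity)) (hu _)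
    push_cast at hpos ⊢
    linarith

/-- Purely real telescoping inequality: for a nonnegative doubly infinite sequence `u` and
constants with A - λ² ≥ 0 and λ² ≥ 0, setting
r m := -(m-2)²λ² u(m-2) + (m-1)(A-2λ²) u(m-1) + (2Am+λ²m²) u m + A(m+1) u(m+1),
for all integers k ≥ j ≥ 0 one has
∑_{i=0}^{k-j} r(N+3+2j+2i) ≥ -(N+1+2j)²λ² u(N+1+2j) + (N+2+2j)(A-2λ²) u(N+2+2j). -/
theorem stmt8
    (A lam : ℝ) (h1 : A - lam ^ 2 ≥ 0) (h2 : lam ^ 2 ≥ 0)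
    (N : ℤ) (hN : 1 ≤ N)
    (u : ℤ → ℝ) (hu : ∀ n : ℤ, 0 ≤ u n)
    (r : ℤ → ℝ)
    (hr : ∀ m : ℤ, r m = -((m : ℝ) - 2) ^ 2 * lam ^ 2 * u (m - 2)
      + ((m : ℝ) - 1) * (A - 2 * lam ^ 2) * u (m - 1)
      + (2 * A * (m : ℝ) + lam ^ 2 * (m : ℝ) ^ 2) * u m
      + A * ((m : ℝ) + 1) * u (m + 1)) :
    ∀ k j : ℤ, 0 ≤ j → j ≤ k →
      ∑ i ∈ Finset.range ((k - j).toNat + 1), r (N + 3 + 2 * j + 2 * (i : ℤ))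
        ≥ -((N : ℝ) + 1 + 2 * (j : ℝ)) ^ 2 * lam ^ 2 * u (N + 1 + 2 * j)
          + ((N : ℝ) + 2 + 2 * (j : ℝ)) * (A - 2 * lam ^ 2) * u (N + 2 + 2 * j) := by
  intro k j hj _
  have hM : 0 ≤ N + 3 + 2 * j := by omega
  have key := boundary_terms_le_sum_step_two h1 hu hr hM (k - j).toNat
  have hA : 0 ≤ A := by linarith
  have hM' : (0 : ℝ) ≤ (N + 3 + 2 * j : ℤ) := by exact_mod_cast hM
  have hpos := mul_nonneg
    (mul_nonneg h2 (sq_nonneg (((N + 3 + 2 * j : ℤ) : ℝ) + 2 * ((k - j).toNat : ℝ))))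
    (hu (N + 3 + 2 * j + 2 * ((k - j).toNat : ℤ)))
  have hpos' : 0 ≤ A * (((N + 3 + 2 * j : ℤ) : ℝ) + 2 * ((k - j).toNat : ℝ) + 1)
      * u (N + 3 + 2 * j + 2 * ((k - j).toNat : ℤ) + 1) :=
    mul_nonneg (by positivity) (hu _)
  have e1 : N + 3 + 2 * j - 2 = N + 1 + 2 * j := by ring
  have e2 : N + 3 + 2 * j - 1 = N + 2 + 2 * j := by ring
  rw [e1, e2] at key
  push_cast at key hpos hpos'
  linarith
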